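/- Let m ≥ 3, R > 0, and u ∈ C²(ℝᵐ) be non-negative on the ball B_R(0) with Δu ≤ f on B_R(0) for some f ∈ C⁰(ℝᵐ). For 1 ≤ p < m/(m-2), q > m, and 0 < r < R/4, there exists C = C(m,R,p,q) > 0 such that r^{-m/p} ‖u‖_{L^p(B_{2r}(0))} ≤ C ( inf_{B_r(0)} u + r^{2-2m/q} ‖f‖_{L^{q/2}(B_R(0))} ). -/

import Mathlib

open Metric MeasureTheory

/-- The Euclidean Laplacian of `u : ℝᵐ → ℝ`, as the trace of the Hessian. -/
noncomputable def euclideanLaplacian {m : ℕ} (u : EuclideanSpace ℝ (Fin m) → ℝ)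
    (x : EuclideanSpace ℝ (Fin m)) : ℝ :=
  ∑ i : Fin m,
    fderiv ℝ (fun y => fderiv ℝ u y (EuclideanSpace.single i 1)) x (EuclideanSpace.single i 1)

open Set Filter Topology

theorem contDiff_fderiv_apply_of_contDiff_two {E : Type*} [NormedAddCommGroup E]
    [NormedSpace ℝ E] {u : E → ℝ} (hu : ContDiff ℝ 2 u) (v : E) :
    ContDiff ℝ 1 (fun y => fderiv ℝ u y v) :=
  (hu.fderiv_right (m := 1) (by norm_num)).clm_apply contDiff_const

theorem continuous_euclideanLaplacian {m : ℕ} {u : EuclideanSpace ℝ (Fin m) → ℝ}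
    (hu : ContDiff ℝ 2 u) : Continuous (euclideanLaplacian u) := by
  unfold euclideanLaplacian
  refine continuous_finsetSum _ fun i _ => ?_
  exact ((contDiff_fderiv_apply_of_contDiff_two hu _).continuous_fderiv (by norm_num)).clm_apply
    continuous_const

theorem euclideanLaplacian_comp_add_smul {m : ℕ} {u : EuclideanSpace ℝ (Fin m) → ℝ}
    (hu : ContDiff ℝ 2 u) (x : EuclideanSpace ℝ (Fin m)) (r : ℝ) (y : EuclideanSpace ℝ (Fin m)) :
    euclideanLaplacian (fun y => u (x + r • y)) y = r ^ 2 * euclideanLaplacian u (x + r • y) := by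
  have key : ∀ (w : EuclideanSpace ℝ (Fin m) → ℝ), Differentiable ℝ w →
      ∀ y v, fderiv ℝ (fun y => w (x + r • y)) y v = r * fderiv ℝ w (x + r • y) v := by
    intro w hw y v
    have h1 : HasFDerivAt (fun y : EuclideanSpace ℝ (Fin m) => x + r • y)
        (r • ContinuousLinearMap.id ℝ _) y :=
      ((hasFDerivAt_id y).const_smul r).const_add x
    have h2 := ((hw (x + r • y)).hasFDerivAt).comp y h1
    have h3 := h2.fderiv
    simp only [Function.comp_def] at h3
    rw [h3]
    simp
  unfold euclideanLaplacian
  rw [Finset.mul_sum]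
  refine Finset.sum_congr rfl fun i _ => ?_
  have hd : Differentiable ℝ (fun y => fderiv ℝ u y (EuclideanSpace.single i 1)) :=
    (contDiff_fderiv_apply_of_contDiff_two hu _).differentiable (by norm_num)
  simp_rw [key u (hu.differentiable (by norm_num))]
  have hd' : DifferentiableAt ℝ
      (fun y => fderiv ℝ u (x + r • y) (EuclideanSpace.single i 1)) y :=
    DifferentiableAt.comp (f := fun y => x + r • y) y (hd _) (by fun_prop)
  rw [fderiv_const_mul hd']
  rw [smul_apply, key _ hd, smul_eq_mul]
  ring

theorem integral_mul_euclideanLaplacian_comm {m : ℕ} {u G : EuclideanSpace ℝ (Fin m) → ℝ}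
    (hu : ContDiff ℝ 2 u) (hG : ContDiff ℝ 2 G) (hc : HasCompactSupport G) :
    ∫ x, G x * euclideanLaplacian u x = ∫ x, u x * euclideanLaplacian G x := by
  have hcont : ∀ {w : EuclideanSpace ℝ (Fin m) → ℝ}, ContDiff ℝ 2 w → ∀ v,
      Continuous (fun y => fderiv ℝ w y v) := fun hw v =>
    (contDiff_fderiv_apply_of_contDiff_two hw v).continuous
  have hcont2 : ∀ {w : EuclideanSpace ℝ (Fin m) → ℝ}, ContDiff ℝ 2 w → ∀ v,
      Continuous (fun y => fderiv ℝ (fun y => fderiv ℝ w y v) y v) := fun hw v =>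
    ((contDiff_fderiv_apply_of_contDiff_two hw v).continuous_fderiv (by norm_num)).clm_apply
      continuous_const
  have hdiff : ∀ {w : EuclideanSpace ℝ (Fin m) → ℝ}, ContDiff ℝ 2 w → ∀ v,
      Differentiable ℝ (fun y => fderiv ℝ w y v) := fun hw v =>
    (contDiff_fderiv_apply_of_contDiff_two hw v).differentiable (by norm_num)
  have hc1 : ∀ v, HasCompactSupport (fun y => fderiv ℝ G y v) := fun v => hc.fderiv_apply (𝕜 := ℝ) v
  have hc2 : ∀ v, HasCompactSupport (fun y => fderiv ℝ (fun y => fderiv ℝ G y v) y v) :=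
    fun v => (hc1 v).fderiv_apply (𝕜 := ℝ) v
  have huc := hu.continuous
  have hGc := hG.continuous
  unfold euclideanLaplacian
  simp_rw [Finset.mul_sum]
  rw [integral_finsetSum, integral_finsetSum]
  · refine Finset.sum_congr rfl fun i _ => ?_
    set v : EuclideanSpace ℝ (Fin m) := EuclideanSpace.single i 1
    have e1 : ∫ x, G x * fderiv ℝ (fun y => fderiv ℝ u y v) x v =
        - ∫ x, fderiv ℝ G x v * fderiv ℝ u x v := by
      refine integral_mul_fderiv_eq_neg_fderiv_mul_of_integrable ?_ ?_ ?_ ?_ ?_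
      · exact ((hcont hG v).mul (hcont hu v)).integrable_of_hasCompactSupport (hc1 v).mul_right
      · exact (hGc.mul (hcont2 hu v)).integrable_of_hasCompactSupport hc.mul_right
      · exact (hGc.mul (hcont hu v)).integrable_of_hasCompactSupport hc.mul_right
      · exact fun x _ => hG.differentiable (by norm_num) x
      · exact fun x _ => hdiff hu v x
    have e2 : ∫ x, u x * fderiv ℝ (fun y => fderiv ℝ G y v) x v =
        - ∫ x, fderiv ℝ u x v * fderiv ℝ G x v := by
      refine integral_mul_fderiv_eq_neg_fderiv_mul_of_integrable ?_ ?_ ?_ ?_ ?_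
      · exact ((hcont hu v).mul (hcont hG v)).integrable_of_hasCompactSupport (hc1 v).mul_left
      · exact (huc.mul (hcont2 hG v)).integrable_of_hasCompactSupport (hc2 v).mul_left
      · exact (huc.mul (hcont hG v)).integrable_of_hasCompactSupport (hc1 v).mul_left
      · exact fun x _ => hu.differentiable (by norm_num) x
      · exact fun x _ => hdiff hG v x
    rw [e1, e2]
    simp_rw [mul_comm]
  · exact fun i _ => (huc.mul (hcont2 hG _)).integrable_of_hasCompactSupport (hc2 _).mul_left
  · exact fun i _ => (hGc.mul (hcont2 hu _)).integrable_of_hasCompactSupport hc.mul_right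

/-- The Laplacian of a function of `‖y‖ ^ 2 + ε`. -/
theorem contDiff_and_euclideanLaplacian_radial {m : ℕ} {g g' g'' : ℝ → ℝ} {ε : ℝ} (hε : 0 < ε)
    (hg : ∀ t, 0 < t → HasDerivAt g (g' t) t) (hg' : ∀ t, 0 < t → HasDerivAt g' (g'' t) t)
    (hg'' : ContinuousOn g'' (Ioi 0)) :
    ContDiff ℝ 2 (fun y : EuclideanSpace ℝ (Fin m) => g (‖y‖ ^ 2 + ε)) ∧
    ∀ y : EuclideanSpace ℝ (Fin m), euclideanLaplacian (fun y => g (‖y‖ ^ 2 + ε)) y =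
      4 * ‖y‖ ^ 2 * g'' (‖y‖ ^ 2 + ε) + 2 * m * g' (‖y‖ ^ 2 + ε) := by
  have hpos : ∀ y : EuclideanSpace ℝ (Fin m), 0 < ‖y‖ ^ 2 + ε := fun y => by positivity
  have hP : ∀ y : EuclideanSpace ℝ (Fin m), HasFDerivAt
      (fun y : EuclideanSpace ℝ (Fin m) => ‖y‖ ^ 2 + ε) (2 • innerSL ℝ y) y := fun y =>
    (hasStrictFDerivAt_norm_sq y).hasFDerivAt.add_const ε
  constructor
  · have c1 : ContDiffOn ℝ 1 g' (Ioi 0) := by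
      rw [show (1 : WithTop ℕ∞) = 0 + 1 by norm_num,
        contDiffOn_succ_iff_deriv_of_isOpen isOpen_Ioi]
      refine ⟨fun t ht => (hg' t ht).differentiableAt.differentiableWithinAt, by simp, ?_⟩
      rw [contDiffOn_zero]
      exact hg''.congr fun t ht => (hg' t ht).deriv
    have c2 : ContDiffOn ℝ 2 g (Ioi 0) := by
      rw [show (2 : WithTop ℕ∞) = 1 + 1 by norm_num,
        contDiffOn_succ_iff_deriv_of_isOpen isOpen_Ioi]
      refine ⟨fun t ht => (hg t ht).differentiableAt.differentiableWithinAt, by simp, ?_⟩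
      exact c1.congr fun t ht => (hg t ht).deriv
    rw [← contDiffOn_univ]
    exact c2.comp ((contDiff_norm_sq ℝ).add contDiff_const).contDiffOn fun y _ => hpos y
  · intro y
    have h1 : ∀ (z v : EuclideanSpace ℝ (Fin m)),
        fderiv ℝ (fun y => g (‖y‖ ^ 2 + ε)) z v = g' (‖z‖ ^ 2 + ε) * (2 * inner ℝ z v) := by
      intro z v
      have := ((hg _ (hpos z)).comp_hasFDerivAt z (hP z)).fderiv
      simp only [Function.comp_def] at this
      rw [this]
      simp
    unfold euclideanLaplacian
    have h2 : ∀ i : Fin m, fderiv ℝ (fun z => fderiv ℝ (fun y => g (‖y‖ ^ 2 + ε)) z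
        (EuclideanSpace.single i 1)) y (EuclideanSpace.single i 1) =
        4 * g'' (‖y‖ ^ 2 + ε) * y i ^ 2 + 2 * g' (‖y‖ ^ 2 + ε) := by
      intro i
      simp_rw [h1]
      have a1 := (hg' _ (hpos y)).comp_hasFDerivAt y (hP y)
      have a2 : HasFDerivAt (fun z : EuclideanSpace ℝ (Fin m) =>
          2 * inner ℝ z (EuclideanSpace.single i (1 : ℝ)))
          ((2 : ℝ) • innerSL ℝ (EuclideanSpace.single i (1 : ℝ))) y := by
        have := ((innerSL ℝ (EuclideanSpace.single i (1 : ℝ))).hasFDerivAt (x := y)).const_mul 2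
        refine this.congr_of_eventuallyEq (Eventually.of_forall fun z => ?_)
        simp [real_inner_comm]
      have a3 := (a1.mul a2).fderiv
      simp only [Function.comp_def, Pi.mul_def] at a3
      rw [a3]
      simp [EuclideanSpace.inner_single_right]
      ring
    simp_rw [h2]
    rw [Finset.sum_add_distrib, ← Finset.mul_sum, EuclideanSpace.real_norm_sq_eq]
    simp
    ring

/-- Gluing a function with the zero function where it vanishes together with its derivative. -/
theorem hasDerivAt_ite_le_zero {g g' : ℝ → ℝ} {b : ℝ}
    (hg : ∀ t, 0 < t → HasDerivAt g (g' t) t) (hb : 0 < b) (h0 : g b = 0) (h1 : g' b = 0) :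
    ∀ t, 0 < t → HasDerivAt (fun t => if t ≤ b then g t else 0) (if t ≤ b then g' t else 0) t := by
  intro t ht
  rcases lt_trichotomy t b with h | h | h
  · rw [if_pos h.le]
    refine (hg t ht).congr_of_eventuallyEq ?_
    filter_upwards [eventually_lt_nhds h] with s hs
    rw [if_pos hs.le]
  · subst h
    rw [if_pos le_rfl, h1, ← hasDerivWithinAt_univ, ← Iic_union_Ici (a := t)]
    refine HasDerivWithinAt.union ?_ ?_
    · have := (hg t ht).hasDerivWithinAt (s := Iic t)
      rw [h1] at this
      exact this.congr (fun s hs => if_pos hs) (if_pos le_rfl)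
    · refine (hasDerivWithinAt_const t (Ici t) (0 : ℝ)).congr (fun s hs => ?_) ?_
      · by_cases hst : s ≤ t
        · rw [if_pos hst, le_antisymm hst hs, h0]
        · rw [if_neg hst]
      · rw [if_pos le_rfl, h0]
  · rw [if_neg h.not_ge]
    refine (hasDerivAt_const t (0 : ℝ)).congr_of_eventuallyEq ?_
    filter_upwards [eventually_gt_nhds h] with s hs
    rw [if_neg hs.not_ge]

/-- The power `t ^ (-β)` minus its second order Taylor polynomial at `B`. -/
noncomputable def powTaylorRemainder (β B t : ℝ) : ℝ :=
  t ^ (-β) - B ^ (-β) - β * B ^ (-β - 1) * (B - t) - β * (β + 1) / 2 * B ^ (-β - 2) * (B - t) ^ 2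

/-- The derivative of `powTaylorRemainder`. -/
noncomputable def powTaylorRemainderDeriv (β B t : ℝ) : ℝ :=
  -β * t ^ (-β - 1) + β * B ^ (-β - 1) + β * (β + 1) * B ^ (-β - 2) * (B - t)

/-- The second derivative of `powTaylorRemainder`. -/
noncomputable def powTaylorRemainderDeriv₂ (β B t : ℝ) : ℝ :=
  β * (β + 1) * (t ^ (-β - 2) - B ^ (-β - 2))

/-- The Taylor remainder of `t ^ (-β)` at `B`, cut off to the right of `B`. As a function of
`t = ‖y‖ ^ 2` with `β = (m - 2) / 2` this is a truncated fundamental solution. -/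
noncomputable def truncatedKernel (β B t : ℝ) : ℝ :=
  if t ≤ B then powTaylorRemainder β B t else 0

theorem hasDerivAt_powTaylorRemainder (β B : ℝ) {t : ℝ} (ht : 0 < t) :
    HasDerivAt (powTaylorRemainder β B) (powTaylorRemainderDeriv β B t) t := by
  have h1 : HasDerivAt (fun t : ℝ => t ^ (-β)) (-β * t ^ (-β - 1)) t :=
    Real.hasDerivAt_rpow_const (Or.inl ht.ne')
  have h2 : HasDerivAt (fun t : ℝ => B - t) (-1) t := (hasDerivAt_id t).const_sub B
  have h3 := ((h1.sub_const (B ^ (-β))).sub (h2.const_mul (β * B ^ (-β - 1)))).sub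
    ((h2.pow 2).const_mul (β * (β + 1) / 2 * B ^ (-β - 2)))
  refine h3.congr_deriv ?_
  unfold powTaylorRemainderDeriv
  simp
  ring

theorem hasDerivAt_powTaylorRemainderDeriv (β B : ℝ) {t : ℝ} (ht : 0 < t) :
    HasDerivAt (powTaylorRemainderDeriv β B) (powTaylorRemainderDeriv₂ β B t) t := by
  have h1 : HasDerivAt (fun t : ℝ => t ^ (-β - 1)) ((-β - 1) * t ^ (-β - 1 - 1)) t :=
    Real.hasDerivAt_rpow_const (Or.inl ht.ne')
  have h2 : HasDerivAt (fun t : ℝ => B - t) (-1) t := (hasDerivAt_id t).const_sub B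
  have h3 := ((h1.const_mul (-β)).add_const (β * B ^ (-β - 1))).add
    (h2.const_mul (β * (β + 1) * B ^ (-β - 2)))
  refine h3.congr_deriv ?_
  unfold powTaylorRemainderDeriv₂
  rw [show -β - 1 - 1 = -β - 2 by ring]
  ring

theorem powTaylorRemainder_self (β B : ℝ) : powTaylorRemainder β B B = 0 := by
  simp [powTaylorRemainder]

theorem powTaylorRemainderDeriv_self (β B : ℝ) : powTaylorRemainderDeriv β B B = 0 := by
  simp [powTaylorRemainderDeriv]

theorem powTaylorRemainderDeriv₂_self (β B : ℝ) : powTaylorRemainderDeriv₂ β B B = 0 := by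
  simp [powTaylorRemainderDeriv₂]

theorem powTaylorRemainderDeriv_neg {β B t : ℝ} (hβ : 0 < β) (ht : 0 < t) (htB : t < B) :
    powTaylorRemainderDeriv β B t < 0 := by
  have hmono : StrictMonoOn (powTaylorRemainderDeriv β B) (Ioc 0 B) := by
    refine strictMonoOn_of_deriv_pos (convex_Ioc 0 B) (fun s hs =>
      (hasDerivAt_powTaylorRemainderDeriv β B hs.1).continuousAt.continuousWithinAt) ?_
    intro s hs
    rw [interior_Ioc] at hs
    rw [(hasDerivAt_powTaylorRemainderDeriv β B hs.1).deriv]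
    have := Real.rpow_lt_rpow_of_neg hs.1 hs.2 (show -β - 2 < 0 by linarith)
    exact mul_pos (by positivity) (by linarith)
  have := hmono ⟨ht, htB.le⟩ ⟨ht.trans htB, le_rfl⟩ htB
  rwa [powTaylorRemainderDeriv_self] at this

theorem strictAntiOn_powTaylorRemainder {β : ℝ} (hβ : 0 < β) (B : ℝ) :
    StrictAntiOn (powTaylorRemainder β B) (Ioc 0 B) := by
  refine strictAntiOn_of_deriv_neg (convex_Ioc 0 B) (fun s hs =>
    (hasDerivAt_powTaylorRemainder β B hs.1).continuousAt.continuousWithinAt) ?_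
  intro s hs
  rw [interior_Ioc] at hs
  rw [(hasDerivAt_powTaylorRemainder β B hs.1).deriv]
  exact powTaylorRemainderDeriv_neg hβ hs.1 hs.2

theorem truncatedKernel_nonneg {β B t : ℝ} (hβ : 0 < β) (ht : 0 < t) :
    0 ≤ truncatedKernel β B t := by
  unfold truncatedKernel
  split_ifs with h
  · have := (strictAntiOn_powTaylorRemainder hβ B).antitoneOn ⟨ht, h⟩ ⟨ht.trans_le h, le_rfl⟩ h
    rwa [powTaylorRemainder_self] at this
  · exact le_rfl

theorem truncatedKernel_le {β B t : ℝ} (hβ : 0 < β) (ht : 0 < t) :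
    truncatedKernel β B t ≤ t ^ (-β) := by
  unfold truncatedKernel
  split_ifs with h
  · have hB : 0 < B := ht.trans_le h
    have h1 : 0 ≤ B ^ (-β) := by positivity
    have h2 : 0 ≤ β * B ^ (-β - 1) * (B - t) := mul_nonneg (by positivity) (by linarith)
    have h3 : 0 ≤ β * (β + 1) / 2 * B ^ (-β - 2) * (B - t) ^ 2 := by positivity
    unfold powTaylorRemainder
    linarith
  · positivity

theorem truncatedKernel_of_le {β B t : ℝ} (h : B ≤ t) : truncatedKernel β B t = 0 := by
  unfold truncatedKernel
  split_ifs with h'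
  · rw [le_antisymm h' h, powTaylorRemainder_self]
  · rfl

theorem exists_pos_le_truncatedKernel {β B s : ℝ} (hβ : 0 < β) (hs : 0 < s) (hsB : s < B) :
    ∃ c, 0 < c ∧ ∀ t, 0 < t → t ≤ s → c ≤ truncatedKernel β B t := by
  have hB : 0 < B := hs.trans hsB
  refine ⟨powTaylorRemainder β B s, ?_, fun t ht hts => ?_⟩
  · have := strictAntiOn_powTaylorRemainder hβ B ⟨hs, hsB.le⟩ ⟨hB, le_rfl⟩ hsB
    rwa [powTaylorRemainder_self] at this
  · rw [truncatedKernel, if_pos (hts.trans hsB.le)]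
    exact (strictAntiOn_powTaylorRemainder hβ B).antitoneOn ⟨ht, hts.trans hsB.le⟩
      ⟨hs, hsB.le⟩ hts

theorem hasDerivAt_truncatedKernel {β B : ℝ} (hB : 0 < B) (t : ℝ) (ht : 0 < t) :
    HasDerivAt (truncatedKernel β B) (if t ≤ B then powTaylorRemainderDeriv β B t else 0) t :=
  hasDerivAt_ite_le_zero (fun _ => hasDerivAt_powTaylorRemainder β B) hB
    (powTaylorRemainder_self β B) (powTaylorRemainderDeriv_self β B) t ht

theorem measurable_truncatedKernel (β B : ℝ) : Measurable (truncatedKernel β B) := by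
  unfold truncatedKernel
  refine Measurable.ite measurableSet_Iic ?_ measurable_const
  unfold powTaylorRemainder
  fun_prop

theorem contDiff_and_euclideanLaplacian_truncatedKernel {m : ℕ} {β B ε : ℝ}
    (hm : (m : ℝ) = 2 * β + 2) (hB : 0 < B) (hε : 0 < ε) :
    ContDiff ℝ 2 (fun y : EuclideanSpace ℝ (Fin m) => truncatedKernel β B (‖y‖ ^ 2 + ε)) ∧
    ∀ y : EuclideanSpace ℝ (Fin m),
      euclideanLaplacian (fun y => truncatedKernel β B (‖y‖ ^ 2 + ε)) y =
      4 * β * (β + 1) * ((if ‖y‖ ^ 2 + ε ≤ B then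
        (β + 2) * B ^ (-β - 2) * (B - (‖y‖ ^ 2 + ε)) + ε * B ^ (-β - 2) else 0) -
        (if ‖y‖ ^ 2 + ε ≤ B then ε * (‖y‖ ^ 2 + ε) ^ (-β - 2) else 0)) := by
  have hcont : ContinuousOn (fun t => if t ≤ B then powTaylorRemainderDeriv₂ β B t else 0)
      (Ioi 0) := by
    have h1 : ContinuousOn (powTaylorRemainderDeriv₂ β B) (Ioi 0) := by
      unfold powTaylorRemainderDeriv₂
      refine continuousOn_const.mul (ContinuousOn.sub ?_ continuousOn_const)
      exact continuousOn_id.rpow_const fun t ht => Or.inl (ne_of_gt ht)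
    refine ContinuousOn.if (fun t ht => ?_) (h1.mono inter_subset_left) continuousOn_const
    have : t = B := by
      have := ht.2
      rw [show {a | a ≤ B} = Iic B from rfl, frontier_Iic] at this
      exact this
    rw [this, powTaylorRemainderDeriv₂_self]
  obtain ⟨h1, h2⟩ := contDiff_and_euclideanLaplacian_radial (m := m) hε
    (hasDerivAt_truncatedKernel (β := β) hB)
    (hasDerivAt_ite_le_zero (fun _ => hasDerivAt_powTaylorRemainderDeriv β B) hB
      (powTaylorRemainderDeriv_self β B) (powTaylorRemainderDeriv₂_self β B)) hcont
  refine ⟨h1, fun y => ?_⟩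
  rw [h2 y]
  have hP : 0 < ‖y‖ ^ 2 + ε := by positivity
  split_ifs with h
  · rw [show ‖y‖ ^ 2 = (‖y‖ ^ 2 + ε) - ε by ring]
    simp only [sub_add_cancel]
    set P := ‖y‖ ^ 2 + ε
    unfold powTaylorRemainderDeriv₂ powTaylorRemainderDeriv
    have e1 : ∀ x : ℝ, 0 < x → x ^ (-β - 1) = x * x ^ (-β - 2) := fun x hx => by
      rw [show -β - 1 = -β - 2 + 1 by ring, Real.rpow_add_one hx.ne']
      ring
    rw [e1 P hP, e1 B hB, hm]
    ring
  · simp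

/-- The total mass of the regularised Dirac kernel `(1 + ‖y‖ ^ 2) ^ (-β - 2)`. -/
noncomputable def japaneseMass (m : ℕ) (β : ℝ) : ℝ :=
  ∫ y : EuclideanSpace ℝ (Fin m), ((1 : ℝ) + ‖y‖ ^ 2) ^ (-β - 2)

theorem integrable_one_add_norm_sq_rpow {m : ℕ} {β : ℝ} (hm : (m : ℝ) = 2 * β + 2) :
    Integrable (fun y : EuclideanSpace ℝ (Fin m) => ((1 : ℝ) + ‖y‖ ^ 2) ^ (-β - 2)) := by
  have := integrable_rpow_neg_one_add_norm_sq (E := EuclideanSpace ℝ (Fin m)) (μ := volume)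
    (r := 2 * β + 4) (by rw [finrank_euclideanSpace_fin]; linarith)
  rwa [show -(2 * β + 4) / 2 = -β - 2 by ring] at this

theorem japaneseMass_pos {m : ℕ} {β : ℝ} (hm : (m : ℝ) = 2 * β + 2) : 0 < japaneseMass m β := by
  unfold japaneseMass
  rw [integral_pos_iff_support_of_nonneg (fun y => by positivity)
    (integrable_one_add_norm_sq_rpow hm)]
  have : Function.support
      (fun y : EuclideanSpace ℝ (Fin m) => ((1 : ℝ) + ‖y‖ ^ 2) ^ (-β - 2)) = univ := by
    ext y
    have : 0 < ((1 : ℝ) + ‖y‖ ^ 2) ^ (-β - 2) := by positivity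
    simpa using this.ne'
  rw [this]
  exact Measure.measure_univ_pos.2 (NeZero.ne _)

theorem integrableOn_norm_rpow_ball {m : ℕ} (hm : 1 ≤ m) {α : ℝ} (hα : α < m) (ρ : ℝ) :
    IntegrableOn (fun y : EuclideanSpace ℝ (Fin m) => ‖y‖ ^ (-α)) (ball 0 ρ) := by
  refine integrableOn_ball_of_norm_le_rpow (C := 1) (α := α) (by simpa using hm) (by simpa using hα)
    (Eventually.of_forall fun y => ?_) (Measurable.aestronglyMeasurable (by fun_prop))
  rw [Real.norm_of_nonneg (by positivity), one_mul]

theorem sq_norm_rpow_neg {E : Type*} [NormedAddCommGroup E] (y : E) (β : ℝ) :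
    (‖y‖ ^ 2) ^ (-β) = ‖y‖ ^ (-(2 * β)) := by
  rw [← Real.rpow_natCast, ← Real.rpow_mul (norm_nonneg y)]
  congr 1
  push_cast
  ring

theorem ae_ne_zero {m : ℕ} (hm : 1 ≤ m) : ∀ᵐ y : EuclideanSpace ℝ (Fin m), y ≠ 0 := by
  have : Nontrivial (EuclideanSpace ℝ (Fin m)) :=
    Module.nontrivial_of_finrank_pos (R := ℝ) (by rw [finrank_euclideanSpace_fin]; omega)
  exact Measure.ae_ne volume 0

theorem exists_norm_le_on_ball {m : ℕ} {v : EuclideanSpace ℝ (Fin m) → ℝ} (hv : Continuous v)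
    (ρ : ℝ) : ∃ K, 0 ≤ K ∧ ∀ y ∈ ball (0 : EuclideanSpace ℝ (Fin m)) ρ, ‖v y‖ ≤ K := by
  obtain ⟨K, hK⟩ := (isCompact_closedBall (0 : EuclideanSpace ℝ (Fin m)) ρ).exists_bound_of_continuousOn
    hv.continuousOn
  exact ⟨max K 0, le_max_right _ _, fun y hy => (hK y (ball_subset_closedBall hy)).trans
    (le_max_left _ _)⟩

theorem mem_ball_sqrt_add_one {E : Type*} [NormedAddCommGroup E] {y : E} {B : ℝ}
    (h : ‖y‖ ^ 2 ≤ B) : y ∈ ball (0 : E) (√B + 1) := by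
  rw [mem_ball_zero_iff]
  have := Real.le_sqrt_of_sq_le h
  linarith

theorem tendsto_integral_truncatedKernel {m : ℕ} {β B : ℝ} (hm : (m : ℝ) = 2 * β + 2)
    (hβ : 0 < β) (hB : 0 < B) {w : EuclideanSpace ℝ (Fin m) → ℝ} (hw : Continuous w) :
    Tendsto (fun δ : ℝ => ∫ y, truncatedKernel β B (‖y‖ ^ 2 + δ ^ 2) * w y) (𝓝[>] 0)
      (𝓝 (∫ y, truncatedKernel β B (‖y‖ ^ 2) * w y)) := by
  have hm1 : 1 ≤ m := by
    have : (0 : ℝ) < m := by linarith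
    exact_mod_cast this
  obtain ⟨K, hK0, hK⟩ := exists_norm_le_on_ball hw (√B + 1)
  refine tendsto_integral_filter_of_dominated_convergence
    ((ball (0 : EuclideanSpace ℝ (Fin m)) (√B + 1)).indicator fun y => ‖y‖ ^ (-(2 * β)) * K)
    ?_ ?_ ?_ ?_
  · refine Eventually.of_forall fun δ => Measurable.aestronglyMeasurable ?_
    exact ((measurable_truncatedKernel β B).comp (by fun_prop)).mul hw.measurable
  · filter_upwards [self_mem_nhdsWithin] with δ hδ
    have hδ : 0 < δ := hδ
    filter_upwards [ae_ne_zero hm1] with y hy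
    have hy0 : 0 < ‖y‖ ^ 2 := by positivity
    by_cases h : ‖y‖ ^ 2 + δ ^ 2 ≤ B
    · have hyb : y ∈ ball (0 : EuclideanSpace ℝ (Fin m)) (√B + 1) :=
        mem_ball_sqrt_add_one (by nlinarith)
      rw [indicator_of_mem hyb, norm_mul]
      refine mul_le_mul ?_ (hK y hyb) (norm_nonneg _) (by positivity)
      rw [Real.norm_of_nonneg (truncatedKernel_nonneg hβ (by positivity)), ← sq_norm_rpow_neg]
      refine (truncatedKernel_le hβ (by positivity)).trans ?_
      exact Real.rpow_le_rpow_of_nonpos hy0 (by nlinarith) (by linarith)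
    · rw [truncatedKernel_of_le (by linarith), zero_mul, norm_zero]
      exact indicator_nonneg (fun z _ => by positivity) y
  · rw [integrable_indicator_iff measurableSet_ball]
    exact (integrableOn_norm_rpow_ball hm1 (by linarith) _).mul_const K
  · filter_upwards [ae_ne_zero hm1] with y hy
    have hy0 : 0 < ‖y‖ ^ 2 := by positivity
    refine Tendsto.mul_const _ ?_
    refine (hasDerivAt_truncatedKernel hB _ hy0).continuousAt.tendsto.comp ?_
    have : Tendsto (fun δ : ℝ => ‖y‖ ^ 2 + δ ^ 2) (𝓝 0) (𝓝 (‖y‖ ^ 2 + 0 ^ 2)) :=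
      Continuous.tendsto (by fun_prop) 0
    simp only [ne_eq, OfNat.ofNat_ne_zero, not_false_eq_true, zero_pow, add_zero] at this
    exact this.mono_left nhdsWithin_le_nhds

theorem tendsto_integral_regular_part {m : ℕ} {a b B : ℝ} (ha : 0 ≤ a) (hb : 0 ≤ b) (hB : 0 < B)
    {v : EuclideanSpace ℝ (Fin m) → ℝ} (hv : Continuous v) :
    Tendsto (fun δ : ℝ => ∫ y, v y * (if ‖y‖ ^ 2 + δ ^ 2 ≤ B then
        a * (B - (‖y‖ ^ 2 + δ ^ 2)) + δ ^ 2 * b else 0)) (𝓝[>] 0)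
      (𝓝 (∫ y, v y * (a * max (B - ‖y‖ ^ 2) 0))) := by
  obtain ⟨K, hK0, hK⟩ := exists_norm_le_on_ball hv (√B + 1)
  refine tendsto_integral_filter_of_dominated_convergence
    ((ball (0 : EuclideanSpace ℝ (Fin m)) (√B + 1)).indicator fun y => K * (a * B + B * b))
    ?_ ?_ ?_ ?_
  · refine Eventually.of_forall fun δ => Measurable.aestronglyMeasurable ?_
    refine hv.measurable.mul (Measurable.ite ?_ (by fun_prop) measurable_const)
    exact measurableSet_le (by fun_prop) (by fun_prop)
  · refine Eventually.of_forall fun δ => Eventually.of_forall fun y => ?_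
    have hy2 := sq_nonneg ‖y‖
    have hδ2 := sq_nonneg δ
    split_ifs with h
    · have hyb : y ∈ ball (0 : EuclideanSpace ℝ (Fin m)) (√B + 1) :=
        mem_ball_sqrt_add_one (by linarith)
      rw [indicator_of_mem hyb, norm_mul]
      refine mul_le_mul (hK y hyb) ?_ (norm_nonneg _) hK0
      have h1 : 0 ≤ B - (‖y‖ ^ 2 + δ ^ 2) := by linarith
      rw [Real.norm_of_nonneg (by positivity)]
      gcongr
      · linarith
      · linarith
    · rw [mul_zero, norm_zero]
      exact indicator_nonneg (fun z _ => by positivity) y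
  · rw [integrable_indicator_iff measurableSet_ball]
    exact integrableOn_const measure_ball_lt_top.ne
  · refine Eventually.of_forall fun y => Tendsto.const_mul _ ?_
    rcases lt_or_ge (‖y‖ ^ 2) B with h | h
    · rw [max_eq_left (by linarith)]
      have h1 : Tendsto (fun δ : ℝ => ‖y‖ ^ 2 + δ ^ 2) (𝓝[>] 0) (𝓝 (‖y‖ ^ 2)) := by
        have : Tendsto (fun δ : ℝ => ‖y‖ ^ 2 + δ ^ 2) (𝓝 0) (𝓝 (‖y‖ ^ 2 + 0 ^ 2)) :=
          Continuous.tendsto (by fun_prop) 0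
        simp only [ne_eq, OfNat.ofNat_ne_zero, not_false_eq_true, zero_pow, add_zero] at this
        exact this.mono_left nhdsWithin_le_nhds
      have h2 : Tendsto (fun δ : ℝ => a * (B - (‖y‖ ^ 2 + δ ^ 2)) + δ ^ 2 * b) (𝓝[>] 0)
          (𝓝 (a * (B - ‖y‖ ^ 2))) := by
        have : Tendsto (fun δ : ℝ => a * (B - (‖y‖ ^ 2 + δ ^ 2)) + δ ^ 2 * b) (𝓝 0)
          (𝓝 (a * (B - (‖y‖ ^ 2 + 0 ^ 2)) + 0 ^ 2 * b)) := Continuous.tendsto (by fun_prop) 0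
        simp only [ne_eq, OfNat.ofNat_ne_zero, not_false_eq_true, zero_pow, add_zero,
          zero_mul] at this
        exact this.mono_left nhdsWithin_le_nhds
      refine h2.congr' ?_
      filter_upwards [h1.eventually (eventually_lt_nhds h)] with δ hδ
      rw [if_pos hδ.le]
    · rw [max_eq_right (by linarith), mul_zero]
      refine tendsto_const_nhds.congr' ?_
      filter_upwards [self_mem_nhdsWithin] with δ hδ
      have hδ : 0 < δ := hδ
      rw [if_neg (by nlinarith)]

theorem tendsto_integral_dirac_part {m : ℕ} {β B : ℝ} (hm : (m : ℝ) = 2 * β + 2) (hB : 0 < B)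
    {v : EuclideanSpace ℝ (Fin m) → ℝ} (hv : Continuous v) :
    Tendsto (fun δ : ℝ => ∫ y, v y * (if ‖y‖ ^ 2 + δ ^ 2 ≤ B then
        δ ^ 2 * (‖y‖ ^ 2 + δ ^ 2) ^ (-β - 2) else 0)) (𝓝[>] 0)
      (𝓝 (japaneseMass m β * v 0)) := by
  obtain ⟨K, hK0, hK⟩ := exists_norm_le_on_ball hv (√B + 1)
  have hsub : ∀ δ : ℝ, 0 < δ → ∫ y, v y * (if ‖y‖ ^ 2 + δ ^ 2 ≤ B then
        δ ^ 2 * (‖y‖ ^ 2 + δ ^ 2) ^ (-β - 2) else 0) =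
      ∫ y : EuclideanSpace ℝ (Fin m), if ‖δ • y‖ ^ 2 + δ ^ 2 ≤ B then
        ((1 : ℝ) + ‖y‖ ^ 2) ^ (-β - 2) * v (δ • y) else 0 := by
    intro δ hδ
    have h := Measure.integral_comp_smul (volume : Measure (EuclideanSpace ℝ (Fin m)))
      (fun y => v y * (if ‖y‖ ^ 2 + δ ^ 2 ≤ B then
        δ ^ 2 * (‖y‖ ^ 2 + δ ^ 2) ^ (-β - 2) else 0)) δ
    rw [finrank_euclideanSpace_fin, abs_of_nonneg (by positivity), smul_eq_mul] at h
    have hδm : δ ^ m ≠ 0 := by positivity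
    have h' : ∀ I J : ℝ, J = (δ ^ m)⁻¹ * I → I = δ ^ m * J := fun I J h => by
      rw [h]; field_simp
    rw [h' _ _ h, ← integral_const_mul]
    refine integral_congr_ae (Eventually.of_forall fun y => ?_)
    dsimp only
    split_ifs with hy
    · have e1 : ‖δ • y‖ ^ 2 + δ ^ 2 = δ ^ 2 * (1 + ‖y‖ ^ 2) := by
        rw [norm_smul, Real.norm_of_nonneg hδ.le]; ring
      have e2 : δ ^ m * δ ^ 2 * (δ ^ 2) ^ (-β - 2) = 1 := by
        rw [← Real.rpow_natCast δ m, ← Real.rpow_natCast δ 2, ← Real.rpow_mul hδ.le,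
          ← Real.rpow_add hδ, ← Real.rpow_add hδ, hm]
        push_cast
        rw [show 2 * β + 2 + 2 + 2 * (-β - 2) = 0 by ring, Real.rpow_zero]
      rw [e1, Real.mul_rpow (by positivity) (by positivity)]
      calc _ = (δ ^ m * δ ^ 2 * (δ ^ 2) ^ (-β - 2)) *
            (((1 : ℝ) + ‖y‖ ^ 2) ^ (-β - 2) * v (δ • y)) := by ring
        _ = _ := by rw [e2, one_mul]
    · simp
  have hlim : Tendsto (fun δ : ℝ => ∫ y : EuclideanSpace ℝ (Fin m),
      if ‖δ • y‖ ^ 2 + δ ^ 2 ≤ B then ((1 : ℝ) + ‖y‖ ^ 2) ^ (-β - 2) * v (δ • y) else 0) (𝓝[>] 0)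
      (𝓝 (∫ y : EuclideanSpace ℝ (Fin m), ((1 : ℝ) + ‖y‖ ^ 2) ^ (-β - 2) * v 0)) := by
    refine tendsto_integral_filter_of_dominated_convergence
      (fun y => ((1 : ℝ) + ‖y‖ ^ 2) ^ (-β - 2) * K) ?_ ?_ ?_ ?_
    · refine Eventually.of_forall fun δ => Measurable.aestronglyMeasurable ?_
      have : Measurable fun y : EuclideanSpace ℝ (Fin m) => v (δ • y) :=
        (hv.comp (continuous_const_smul δ)).measurable
      refine Measurable.ite ?_ (by fun_prop) measurable_const
      exact measurableSet_le (by fun_prop) (by fun_prop)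
    · refine Eventually.of_forall fun δ => Eventually.of_forall fun y => ?_
      split_ifs with h
      · rw [norm_mul, Real.norm_of_nonneg (by positivity)]
        gcongr
        exact hK _ (mem_ball_sqrt_add_one (by nlinarith [sq_nonneg δ]))
      · rw [norm_zero]
        positivity
    · exact (integrable_one_add_norm_sq_rpow hm).mul_const K
    · refine Eventually.of_forall fun y => ?_
      have h1 : Tendsto (fun δ : ℝ => ‖δ • y‖ ^ 2 + δ ^ 2) (𝓝[>] 0) (𝓝 0) := by
        have : Tendsto (fun δ : ℝ => ‖δ • y‖ ^ 2 + δ ^ 2) (𝓝 0)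
            (𝓝 (‖(0 : ℝ) • y‖ ^ 2 + 0 ^ 2)) := Continuous.tendsto (by fun_prop) 0
        simp only [zero_smul, norm_zero, ne_eq, OfNat.ofNat_ne_zero, not_false_eq_true, zero_pow,
          add_zero] at this
        exact this.mono_left nhdsWithin_le_nhds
      have h2 : Tendsto (fun δ : ℝ => ((1 : ℝ) + ‖y‖ ^ 2) ^ (-β - 2) * v (δ • y)) (𝓝[>] 0)
          (𝓝 (((1 : ℝ) + ‖y‖ ^ 2) ^ (-β - 2) * v 0)) := by
        have : Tendsto (fun δ : ℝ => ((1 : ℝ) + ‖y‖ ^ 2) ^ (-β - 2) * v (δ • y)) (𝓝 0)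
            (𝓝 (((1 : ℝ) + ‖y‖ ^ 2) ^ (-β - 2) * v ((0 : ℝ) • y))) :=
          Continuous.tendsto (by fun_prop) 0
        rw [zero_smul] at this
        exact this.mono_left nhdsWithin_le_nhds
      refine h2.congr' ?_
      filter_upwards [h1.eventually (eventually_lt_nhds hB)] with δ hδ
      rw [if_pos hδ.le]
  rw [integral_mul_const] at hlim
  refine hlim.congr' ?_
  filter_upwards [self_mem_nhdsWithin] with δ hδ
  exact (hsub δ hδ).symm

/-- A mean value formula with remainder: the truncated fundamental solution tested against the
Laplacian of `v`. -/
theorem integral_truncatedKernel_mul_euclideanLaplacian {m : ℕ} {β B : ℝ}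
    (hm : (m : ℝ) = 2 * β + 2) (hβ : 0 < β) (hB : 0 < B)
    {v : EuclideanSpace ℝ (Fin m) → ℝ} (hv : ContDiff ℝ 2 v) :
    ∫ y, truncatedKernel β B (‖y‖ ^ 2) * euclideanLaplacian v y =
      4 * β * (β + 1) * ((∫ y, v y * ((β + 2) * B ^ (-β - 2) * max (B - ‖y‖ ^ 2) 0)) -
        japaneseMass m β * v 0) := by
  have h1 := tendsto_integral_truncatedKernel hm hβ hB (continuous_euclideanLaplacian hv)
  have h2 := tendsto_integral_regular_part (a := (β + 2) * B ^ (-β - 2)) (b := B ^ (-β - 2))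
    (by positivity) (by positivity) hB hv.continuous
  have h3 := tendsto_integral_dirac_part hm hB hv.continuous
  refine tendsto_nhds_unique h1 (((h2.sub h3).const_mul (4 * β * (β + 1))).congr' ?_)
  filter_upwards [self_mem_nhdsWithin] with δ hδ
  have hδ : 0 < δ := hδ
  have hδ2 : 0 < δ ^ 2 := by positivity
  obtain ⟨hG, hL⟩ := contDiff_and_euclideanLaplacian_truncatedKernel hm hB hδ2
  have hsupp : ∀ y : EuclideanSpace ℝ (Fin m), y ∉ closedBall 0 (√B + 1) →
      ¬ (‖y‖ ^ 2 + δ ^ 2 ≤ B) := fun y hy h =>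
    hy (ball_subset_closedBall (mem_ball_sqrt_add_one (by linarith)))
  have hc : HasCompactSupport
      (fun y : EuclideanSpace ℝ (Fin m) => truncatedKernel β B (‖y‖ ^ 2 + δ ^ 2)) :=
    HasCompactSupport.intro (isCompact_closedBall 0 (√B + 1)) fun y hy =>
      truncatedKernel_of_le (not_le.1 (hsupp y hy)).le
  rw [integral_mul_euclideanLaplacian_comm hv hG hc]
  simp_rw [hL]
  have hvc := hv.continuous
  have hInt : ∀ F : EuclideanSpace ℝ (Fin m) → ℝ, Continuous F →
      Integrable fun y => v y * (if ‖y‖ ^ 2 + δ ^ 2 ≤ B then F y else 0) := by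
    intro F hF
    have hset : MeasurableSet {y : EuclideanSpace ℝ (Fin m) | ‖y‖ ^ 2 + δ ^ 2 ≤ B} :=
      measurableSet_le (by fun_prop) (by fun_prop)
    have h : IntegrableOn (fun y => v y * F y)
        {y : EuclideanSpace ℝ (Fin m) | ‖y‖ ^ 2 + δ ^ 2 ≤ B} :=
      ((hvc.mul hF).locallyIntegrable.integrableOn_isCompact
        (isCompact_closedBall (0 : EuclideanSpace ℝ (Fin m)) (√B + 1))).mono_set
        fun y hy => by_contra fun h => hsupp y h hy
    rw [← integrable_indicator_iff hset] at h
    refine h.congr (Eventually.of_forall fun y => ?_)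
    simp [indicator_apply]
  rw [← integral_sub, ← integral_const_mul]
  · refine integral_congr_ae (Eventually.of_forall fun y => ?_)
    dsimp only
    ring
  · exact hInt _ (by fun_prop)
  · refine hInt _ (continuous_const.mul (Continuous.rpow_const (by fun_prop) fun y => Or.inl ?_))
    positivity

theorem integrableOn_truncatedKernel_mul {m : ℕ} {β B : ℝ} (hm : (m : ℝ) = 2 * β + 2)
    (hβ : 0 < β) {w : EuclideanSpace ℝ (Fin m) → ℝ} (hw : Continuous w) (ρ : ℝ) :
    IntegrableOn (fun y => truncatedKernel β B (‖y‖ ^ 2) * w y) (ball 0 ρ) := by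
  have hm1 : 1 ≤ m := by
    have : (0 : ℝ) < m := by linarith
    exact_mod_cast this
  obtain ⟨K, hK0, hK⟩ := exists_norm_le_on_ball hw ρ
  refine Integrable.mono' ((integrableOn_norm_rpow_ball hm1 (α := 2 * β) (by linarith) ρ).mul_const K)
    ?_ ?_
  · refine Measurable.aestronglyMeasurable ?_
    exact ((measurable_truncatedKernel β B).comp (by fun_prop)).mul hw.measurable
  · filter_upwards [ae_restrict_mem measurableSet_ball, ae_restrict_of_ae (ae_ne_zero hm1)]
      with y hy hy0
    have : 0 < ‖y‖ ^ 2 := by positivity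
    rw [norm_mul, Real.norm_of_nonneg (truncatedKernel_nonneg hβ this), ← sq_norm_rpow_neg]
    exact mul_le_mul (truncatedKernel_le hβ this) (hK y hy) (norm_nonneg _) (by positivity)

theorem setIntegral_truncatedKernel_mul_euclideanLaplacian {m : ℕ} {β ρ : ℝ}
    (hm : (m : ℝ) = 2 * β + 2) (hβ : 0 < β) (hρ : 0 < ρ)
    {u : EuclideanSpace ℝ (Fin m) → ℝ} (hu : ContDiff ℝ 2 u) (x : EuclideanSpace ℝ (Fin m)) :
    ∫ y in ball 0 ρ, truncatedKernel β (ρ ^ 2) (‖y‖ ^ 2) * euclideanLaplacian u (x + y) =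
      4 * β * (β + 1) * ((∫ y in ball 0 ρ, u (x + y) *
        ((β + 2) * (ρ ^ 2) ^ (-β - 2) * (ρ ^ 2 - ‖y‖ ^ 2))) - japaneseMass m β * u x) := by
  have hv : ContDiff ℝ 2 (fun y => u (x + (1 : ℝ) • y)) :=
    hu.comp (by fun_prop)
  have h := integral_truncatedKernel_mul_euclideanLaplacian hm hβ (B := ρ ^ 2) (by positivity) hv
  simp_rw [euclideanLaplacian_comp_add_smul hu] at h
  simp only [one_smul, one_pow, one_mul, add_zero] at h
  have hout : ∀ y : EuclideanSpace ℝ (Fin m), y ∉ ball 0 ρ → ρ ^ 2 ≤ ‖y‖ ^ 2 := fun y hy => by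
    rw [mem_ball_zero_iff, not_lt] at hy
    gcongr
  rw [setIntegral_eq_integral_of_forall_compl_eq_zero fun y hy => by
    rw [truncatedKernel_of_le (hout y hy), zero_mul], h]
  congr 2
  rw [← setIntegral_eq_integral_of_forall_compl_eq_zero (s := ball 0 ρ) fun y hy => by
    rw [max_eq_right (by linarith [hout y hy]), mul_zero, mul_zero]]
  refine setIntegral_congr_fun measurableSet_ball fun y hy => ?_
  rw [mem_ball_zero_iff] at hy
  rw [max_eq_left]
  have : ‖y‖ ^ 2 ≤ ρ ^ 2 := by gcongr
  linarith

theorem integrableOn_ball_of_continuous {m : ℕ} {w : EuclideanSpace ℝ (Fin m) → ℝ}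
    (hw : Continuous w) (x : EuclideanSpace ℝ (Fin m)) (ρ : ℝ) : IntegrableOn w (ball x ρ) :=
  (hw.locallyIntegrable.integrableOn_isCompact (isCompact_closedBall x ρ)).mono_set
    ball_subset_closedBall

theorem setIntegral_ball_comp_add {m : ℕ} (w : EuclideanSpace ℝ (Fin m) → ℝ)
    (x : EuclideanSpace ℝ (Fin m)) (ρ : ℝ) : ∫ y in ball 0 ρ, w (x + y) = ∫ y in ball x ρ, w y := by
  rw [← (measurePreserving_add_left volume x).setIntegral_preimage_emb
    (measurableEmbedding_addLeft x) w]
  congr 2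
  ext y
  simp

/-- Hölder's inequality against the Newtonian kernel. -/
theorem exists_setIntegral_newton_mul_le {m : ℕ} {β s : ℝ} (hm : (m : ℝ) = 2 * β + 2)
    (hβ : 0 < β) (hs : β + 1 < s) :
    ∃ C, 0 ≤ C ∧ ∀ f : EuclideanSpace ℝ (Fin m) → ℝ, Continuous f →
      ∀ x ∈ ball (0 : EuclideanSpace ℝ (Fin m)) 1,
      ∫ y in ball 0 3, ‖y‖ ^ (-(2 * β)) * |f (x + y)| ≤
        C * (∫ y in ball (0 : EuclideanSpace ℝ (Fin m)) 4, |f y| ^ s) ^ (1 / s) := by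
  have hm1 : 1 ≤ m := by
    have : (0 : ℝ) < m := by linarith
    exact_mod_cast this
  have hs1 : 1 < s := by linarith
  have hs0 : 0 < s := by linarith
  have hconj := (Real.HolderConjugate.conjExponent hs1).symm
  set s' := s.conjExponent with hs'
  have hs'0 : 0 < s' := hconj.pos
  have hlt : 2 * β * s' < m := by
    rw [hs', Real.conjExponent, mul_div_assoc', div_lt_iff₀ (by linarith), hm]
    nlinarith
  refine ⟨(∫ y in ball (0 : EuclideanSpace ℝ (Fin m)) 3, (‖y‖ ^ (-(2 * β))) ^ s') ^ (1 / s'),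
    by positivity, fun f hf x hx => ?_⟩
  have hInt : ∀ ρ z, IntegrableOn (fun y => |f y| ^ s) (ball z ρ) := fun ρ z =>
    integrableOn_ball_of_continuous (hf.abs.rpow_const fun _ => Or.inr hs0.le) z ρ
  have h := integral_mul_le_Lp_mul_Lq_of_nonneg hconj
    (μ := volume.restrict (ball (0 : EuclideanSpace ℝ (Fin m)) 3))
    (f := fun y => ‖y‖ ^ (-(2 * β))) (g := fun y => |f (x + y)|)
    (Eventually.of_forall fun y => by positivity) (Eventually.of_forall fun y => by positivity)
    ?_ ?_
  · refine h.trans (mul_le_mul_of_nonneg_left ?_ (by positivity))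
    refine Real.rpow_le_rpow (integral_nonneg fun y => by positivity) ?_ (by positivity)
    rw [setIntegral_ball_comp_add (fun y => |f y| ^ s)]
    refine setIntegral_mono_set (hInt 4 0) (Eventually.of_forall fun y => by positivity)
      (LE.le.eventuallyLE (ball_subset_ball' ?_))
    rw [mem_ball] at hx
    linarith
  · rw [← integrable_norm_rpow_iff (Measurable.aestronglyMeasurable (by fun_prop))
      (by simpa using hs'0) ENNReal.ofReal_ne_top, ENNReal.toReal_ofReal hs'0.le]
    refine (integrableOn_norm_rpow_ball hm1 hlt 3).congr (Eventually.of_forall fun y => ?_)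
    dsimp only
    rw [Real.norm_of_nonneg (by positivity), ← Real.rpow_mul (norm_nonneg y)]
    congr 1
    ring
  · have hc : Continuous fun y => |f (x + y)| := by fun_prop
    rw [← integrable_norm_rpow_iff hc.measurable.aestronglyMeasurable
      (by simpa using hs0) ENNReal.ofReal_ne_top, ENNReal.toReal_ofReal hs0.le]
    simp only [Real.norm_eq_abs, abs_abs]
    exact integrableOn_ball_of_continuous (hc.rpow_const fun _ => Or.inr hs0.le) 0 3

/-- A supersolution and the positive part of `-Δu` are controlled in mean by a value at a point. -/
theorem exists_setIntegral_le_apply_add {m : ℕ} {β s : ℝ} (hm : (m : ℝ) = 2 * β + 2)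
    (hβ : 0 < β) (hs : β + 1 < s) :
    ∃ C, 0 < C ∧ ∀ u f : EuclideanSpace ℝ (Fin m) → ℝ, ContDiff ℝ 2 u → Continuous f →
      (∀ x ∈ ball 0 4, 0 ≤ u x) → (∀ x ∈ ball 0 4, euclideanLaplacian u x ≤ f x) →
      ∀ x ∈ ball 0 1,
      ∫ y in ball x (29 / 10), u y ≤
        C * (u x + (∫ y in ball (0 : EuclideanSpace ℝ (Fin m)) 4, |f y| ^ s) ^ (1 / s)) ∧
      ∫ y in ball x (29 / 10), max (-euclideanLaplacian u y) 0 ≤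
        C * (u x + (∫ y in ball (0 : EuclideanSpace ℝ (Fin m)) 4, |f y| ^ s) ^ (1 / s)) := by
  have hm1 : 1 ≤ m := by
    have : (0 : ℝ) < m := by linarith
    exact_mod_cast this
  obtain ⟨CF, hCF0, hCF⟩ := exists_setIntegral_newton_mul_le hm hβ hs
  obtain ⟨c, hc0, hc⟩ := exists_pos_le_truncatedKernel (β := β) (B := 3 ^ 2) (s := (29 / 10) ^ 2) hβ
    (by norm_num) (by norm_num)
  have hS := japaneseMass_pos hm
  set S := japaneseMass m β
  set κ := 4 * β * (β + 1) with hκ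
  have hκ0 : 0 < κ := by positivity
  set a : ℝ := (β + 2) * (3 ^ 2) ^ (-β - 2) with ha
  have ha0 : 0 < a := by positivity
  set D := κ * S + CF with hD
  have hD0 : 0 < D := by positivity
  set b : ℝ := κ * (a * (59 / 100)) with hb
  have hb0 : 0 < b := by positivity
  refine ⟨D / c + D / b, by positivity, fun u f hu hf hu0 hle x hx => ?_⟩
  set F := (∫ y in ball (0 : EuclideanSpace ℝ (Fin m)) 4, |f y| ^ s) ^ (1 / s) with hF
  have hF0 : 0 ≤ F := by positivity
  have hball : ∀ y : EuclideanSpace ℝ (Fin m), y ∈ ball 0 3 → x + y ∈ ball 0 4 := fun y hy => by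
    rw [mem_ball_zero_iff] at *
    linarith [norm_add_le x y]
  have hux : 0 ≤ u x := hu0 x (ball_subset_ball (by norm_num) hx)
  set L := fun y => euclideanLaplacian u (x + y) with hL
  have hLc : Continuous L := (continuous_euclideanLaplacian hu).comp (by fun_prop)
  have huc : Continuous fun y => u (x + y) := hu.continuous.comp (by fun_prop)
  set k : EuclideanSpace ℝ (Fin m) → ℝ := fun y => truncatedKernel β (3 ^ 2) (‖y‖ ^ 2) with hk
  have hInt : ∀ {w : EuclideanSpace ℝ (Fin m) → ℝ}, Continuous w → ∀ ρ,
      IntegrableOn (fun y => k y * w y) (ball 0 ρ) := fun hw ρ =>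
    integrableOn_truncatedKernel_mul hm hβ hw ρ
  have hneg : Continuous fun y => max (-L y) 0 := by fun_prop
  have hpos : Continuous fun y => max (L y) 0 := by fun_prop
  have hid := setIntegral_truncatedKernel_mul_euclideanLaplacian hm hβ (ρ := 3) (by norm_num) hu x
  have hsplit : ∫ y in ball 0 3, k y * L y =
      (∫ y in ball 0 3, k y * max (L y) 0) - ∫ y in ball 0 3, k y * max (-L y) 0 := by
    rw [← integral_sub (hInt hpos 3) (hInt hneg 3)]
    refine integral_congr_ae (Eventually.of_forall fun y => ?_)
    dsimp only
    rcases le_total (L y) 0 with h | h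
    · rw [max_eq_right h, max_eq_left (by linarith)]; ring
    · rw [max_eq_left h, max_eq_right (by linarith)]; ring
  set J := ∫ y in ball 0 3, u (x + y) * (a * (3 ^ 2 - ‖y‖ ^ 2)) with hJ
  have hid' : ∫ y in ball 0 3, k y * L y = κ * (J - S * u x) := hid
  have hposle : ∫ y in ball 0 3, k y * max (L y) 0 ≤ CF * F := by
    refine le_trans ?_ (hCF f hf x hx)
    obtain ⟨K, hK0, hK⟩ := exists_norm_le_on_ball (v := fun y => |f (x + y)|) (by fun_prop) 3
    refine setIntegral_mono_ae_restrict (hInt hpos 3) ?_ ?_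
    · refine Integrable.mono'
        ((integrableOn_norm_rpow_ball hm1 (α := 2 * β) (by linarith) 3).mul_const K)
        (Measurable.aestronglyMeasurable ?_) ?_
      · have : Measurable fun y => |f (x + y)| :=
          Continuous.measurable (by fun_prop)
        fun_prop
      · filter_upwards [ae_restrict_mem measurableSet_ball] with y hy
        rw [norm_mul, Real.norm_of_nonneg (by positivity)]
        exact mul_le_mul_of_nonneg_left (hK y hy) (by positivity)
    · filter_upwards [ae_restrict_mem measurableSet_ball, ae_restrict_of_ae (ae_ne_zero hm1)]
        with y hy hy0
      have : 0 < ‖y‖ ^ 2 := by positivity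
      rw [← sq_norm_rpow_neg]
      refine mul_le_mul (truncatedKernel_le hβ this) ?_ (le_max_right _ _) (by positivity)
      exact max_le ((hle _ (hball y hy)).trans (le_abs_self _)) (abs_nonneg _)
  have hsub : ball (0 : EuclideanSpace ℝ (Fin m)) (29 / 10) ⊆ ball 0 3 :=
    ball_subset_ball (by norm_num)
  have hJle : (a * (59 / 100)) * ∫ y in ball 0 (29 / 10), u (x + y) ≤ J := by
    have hic : Continuous fun y => u (x + y) * (a * (3 ^ 2 - ‖y‖ ^ 2)) := by fun_prop
    rw [← integral_const_mul]
    refine (setIntegral_mono_on ((integrableOn_ball_of_continuous huc 0 _).const_mul _)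
      (integrableOn_ball_of_continuous hic 0 _) measurableSet_ball fun y hy => ?_).trans
      (setIntegral_mono_set (integrableOn_ball_of_continuous hic 0 3) ?_ hsub.eventuallyLE)
    · have h0 := hu0 _ (hball y (hsub hy))
      rw [mem_ball_zero_iff] at hy
      rw [mul_comm]
      refine mul_le_mul_of_nonneg_left (mul_le_mul_of_nonneg_left ?_ ha0.le) h0
      nlinarith [norm_nonneg y]
    · filter_upwards [ae_restrict_mem measurableSet_ball] with y hy
      have h0 := hu0 _ (hball y hy)
      rw [mem_ball_zero_iff] at hy
      refine mul_nonneg h0 (mul_nonneg ha0.le ?_)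
      nlinarith [norm_nonneg y]
  have hkle : c * ∫ y in ball 0 (29 / 10), max (-L y) 0 ≤ ∫ y in ball 0 3, k y * max (-L y) 0 := by
    rw [← integral_const_mul]
    refine (setIntegral_mono_ae_restrict ((integrableOn_ball_of_continuous hneg 0 _).const_mul _)
      (hInt hneg _) ?_).trans (setIntegral_mono_set (hInt hneg 3) ?_ hsub.eventuallyLE)
    · filter_upwards [ae_restrict_mem measurableSet_ball, ae_restrict_of_ae (ae_ne_zero hm1)]
        with y hy hy0
      rw [mem_ball_zero_iff] at hy
      refine mul_le_mul_of_nonneg_right (hc _ (by positivity) ?_) (le_max_right _ _)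
      gcongr
    · filter_upwards [ae_restrict_of_ae (ae_ne_zero hm1)] with y hy0
      exact mul_nonneg (truncatedKernel_nonneg hβ (by positivity)) (le_max_right _ _)
  have hI0 : 0 ≤ ∫ y in ball 0 (29 / 10), u (x + y) :=
    setIntegral_nonneg measurableSet_ball fun y hy => hu0 _ (hball y (hsub hy))
  have hN0 : 0 ≤ ∫ y in ball 0 (29 / 10), max (-L y) 0 :=
    integral_nonneg fun y => le_max_right _ _
  have htot : κ * S * u x + CF * F ≤ D * (u x + F) := by
    have h1 : 0 ≤ CF * u x := by positivity
    have h2 : 0 ≤ κ * S * F := by positivity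
    rw [hD]
    linarith
  rw [← setIntegral_ball_comp_add u, ← setIntegral_ball_comp_add fun y =>
    max (-euclideanLaplacian u y) 0]
  have hJ0 : 0 ≤ J := le_trans (by positivity) hJle
  have hκJ : κ * ((a * (59 / 100)) * ∫ y in ball 0 (29 / 10), u (x + y)) ≤ κ * J :=
    mul_le_mul_of_nonneg_left hJle hκ0.le
  have hκJ0 : 0 ≤ κ * J := by positivity
  have hcN : 0 ≤ c * ∫ y in ball 0 (29 / 10), max (-L y) 0 := by positivity
  have hsum : 0 ≤ u x + F := by positivity
  rw [add_mul, div_mul_eq_mul_div, div_mul_eq_mul_div]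
  constructor
  · refine le_trans ?_ (le_add_of_nonneg_left (by positivity))
    rw [le_div_iff₀ hb0, hb]
    linarith
  · refine le_trans ?_ (le_add_of_nonneg_right (by positivity))
    rw [le_div_iff₀ hc0]
    change (∫ y in ball 0 (29 / 10), max (-L y) 0) * c ≤ _
    linarith

/-- The estimate of `exists_setIntegral_le_apply_add` on a ball with a fixed centre. -/
theorem exists_setIntegral_ball_zero_le_apply_add {m : ℕ} {β s : ℝ} (hm : (m : ℝ) = 2 * β + 2)
    (hβ : 0 < β) (hs : β + 1 < s) :
    ∃ C, 0 < C ∧ ∀ u f : EuclideanSpace ℝ (Fin m) → ℝ, ContDiff ℝ 2 u → Continuous f →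
      (∀ x ∈ ball 0 4, 0 ≤ u x) → (∀ x ∈ ball 0 4, euclideanLaplacian u x ≤ f x) →
      ∀ x ∈ ball 0 1,
      ∫ y in ball 0 (5 / 2), u y ≤
        C * (u x + (∫ y in ball (0 : EuclideanSpace ℝ (Fin m)) 4, |f y| ^ s) ^ (1 / s)) ∧
      ∫ y in ball 0 (5 / 2), max (-euclideanLaplacian u y) 0 ≤
        C * (u x + (∫ y in ball (0 : EuclideanSpace ℝ (Fin m)) 4, |f y| ^ s) ^ (1 / s)) := by
  obtain ⟨C, hC0, hC⟩ := exists_setIntegral_le_apply_add hm hβ hs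
  set V := volume.real (ball (0 : EuclideanSpace ℝ (Fin m)) (1 / 4)) with hV
  have hV0 : 0 < V := ENNReal.toReal_pos (measure_ball_pos _ _ (by norm_num)).ne' measure_ball_lt_top.ne
  refine ⟨C * (V⁻¹ * C + 1), by positivity, fun u f hu hf hu0 hle x hx => ?_⟩
  set F := (∫ y in ball (0 : EuclideanSpace ℝ (Fin m)) 4, |f y| ^ s) ^ (1 / s) with hF
  have hF0 : 0 ≤ F := by positivity
  have hux : 0 ≤ u x := hu0 x (ball_subset_ball (by norm_num) hx)
  have hx1 : dist x 0 < 1 := hx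
  obtain ⟨z, hz, hzle⟩ := exists_le_setAverage (μ := volume)
    (s := ball (0 : EuclideanSpace ℝ (Fin m)) (1 / 4)) (f := u)
    (measure_ball_pos _ _ (by norm_num)).ne' measure_ball_lt_top.ne
    (integrableOn_ball_of_continuous hu.continuous _ _)
  have hz1 : dist z 0 < 1 / 4 := hz
  have hsub1 : ball (0 : EuclideanSpace ℝ (Fin m)) (1 / 4) ⊆ ball x (29 / 10) :=
    ball_subset_ball' (by rw [dist_comm]; linarith)
  have hsub2 : ball (0 : EuclideanSpace ℝ (Fin m)) (5 / 2) ⊆ ball z (29 / 10) :=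
    ball_subset_ball' (by rw [dist_comm]; linarith)
  have hpos : ∀ w ∈ ball (0 : EuclideanSpace ℝ (Fin m)) 1, ∀ y ∈ ball w (29 / 10), 0 ≤ u y :=
    fun w hw y hy => hu0 y (ball_subset_ball' (by rw [mem_ball] at hw; linarith) hy)
  have hz' : z ∈ ball (0 : EuclideanSpace ℝ (Fin m)) 1 := ball_subset_ball (by norm_num) hz
  have hzx : u z ≤ V⁻¹ * (C * (u x + F)) := by
    rw [setAverage_eq, smul_eq_mul] at hzle
    refine hzle.trans (mul_le_mul_of_nonneg_left ?_ (by positivity))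
    refine le_trans ?_ (hC u f hu hf hu0 hle x hx).1
    refine setIntegral_mono_set (integrableOn_ball_of_continuous hu.continuous _ _) ?_
      hsub1.eventuallyLE
    filter_upwards [ae_restrict_mem measurableSet_ball] with y hy using hpos x hx y hy
  have hfin : C * (u z + F) ≤ C * (V⁻¹ * C + 1) * (u x + F) := by
    rw [mul_assoc]
    refine mul_le_mul_of_nonneg_left ?_ hC0.le
    linarith
  obtain ⟨h1, h2⟩ := hC u f hu hf hu0 hle z hz'
  have hLc := continuous_euclideanLaplacian hu
  constructor
  · refine le_trans ?_ (h1.trans hfin)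
    refine setIntegral_mono_set (integrableOn_ball_of_continuous hu.continuous _ _) ?_
      hsub2.eventuallyLE
    filter_upwards [ae_restrict_mem measurableSet_ball] with y hy using hpos z hz' y hy
  · refine le_trans ?_ (h2.trans hfin)
    exact setIntegral_mono_set (integrableOn_ball_of_continuous (by fun_prop) _ _)
      (Eventually.of_forall fun y => le_max_right _ _) hsub2.eventuallyLE

/-- Local representation of a supersolution by the Newtonian potential of `(-Δu)⁺`. -/
theorem exists_apply_le_newton_add {m : ℕ} {β : ℝ} (hm : (m : ℝ) = 2 * β + 2) (hβ : 0 < β) :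
    ∃ C, 0 < C ∧ ∀ u : EuclideanSpace ℝ (Fin m) → ℝ, ContDiff ℝ 2 u →
      (∀ x ∈ ball 0 4, 0 ≤ u x) → ∀ x ∈ ball 0 2,
      u x ≤ C * ((∫ y in ball 0 (1 / 2), ‖y‖ ^ (-(2 * β)) * max (-euclideanLaplacian u (x + y)) 0) +
        ∫ y in ball 0 (5 / 2), u y) := by
  have hm1 : 1 ≤ m := by
    have : (0 : ℝ) < m := by linarith
    exact_mod_cast this
  have hS := japaneseMass_pos hm
  set S := japaneseMass m β
  set κ := 4 * β * (β + 1) with hκ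
  have hκ0 : 0 < κ := by positivity
  set a : ℝ := (β + 2) * ((1 / 2) ^ 2) ^ (-β - 2) with ha
  have ha0 : 0 < a := by positivity
  refine ⟨(1 + κ * a) / (κ * S), by positivity, fun u hu hu0 x hx => ?_⟩
  have hx2 : dist x 0 < 2 := hx
  have hsub : ball x (1 / 2) ⊆ ball 0 (5 / 2) := ball_subset_ball' (by linarith)
  have hsub4 : ball (0 : EuclideanSpace ℝ (Fin m)) (5 / 2) ⊆ ball 0 4 :=
    ball_subset_ball (by norm_num)
  have hid := setIntegral_truncatedKernel_mul_euclideanLaplacian hm hβ (ρ := 1 / 2) (by norm_num)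
    hu x
  have hLc : Continuous fun y => euclideanLaplacian u (x + y) :=
    (continuous_euclideanLaplacian hu).comp (by fun_prop)
  have huc : Continuous fun y => u (x + y) := hu.continuous.comp (by fun_prop)
  have hball : ∀ y : EuclideanSpace ℝ (Fin m), y ∈ ball 0 (1 / 2) → 0 ≤ u (x + y) := fun y hy =>
    hu0 _ (hsub4 (hsub (by simpa using hy)))
  have h1 : -∫ y in ball 0 (1 / 2), truncatedKernel β ((1 / 2) ^ 2) (‖y‖ ^ 2) *
        euclideanLaplacian u (x + y) ≤
      ∫ y in ball 0 (1 / 2), ‖y‖ ^ (-(2 * β)) * max (-euclideanLaplacian u (x + y)) 0 := by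
    rw [← integral_neg]
    obtain ⟨K, hK0, hK⟩ := exists_norm_le_on_ball
      (v := fun y => max (-euclideanLaplacian u (x + y)) 0) (by fun_prop) (1 / 2)
    refine setIntegral_mono_ae_restrict (integrableOn_truncatedKernel_mul hm hβ hLc _).neg ?_ ?_
    · refine Integrable.mono'
        ((integrableOn_norm_rpow_ball hm1 (α := 2 * β) (by linarith) (1 / 2)).mul_const K)
        (Measurable.aestronglyMeasurable ?_) ?_
      · have : Measurable fun y => euclideanLaplacian u (x + y) := hLc.measurable
        fun_prop
      · filter_upwards [ae_restrict_mem measurableSet_ball] with y hy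
        rw [norm_mul, Real.norm_of_nonneg (by positivity)]
        exact mul_le_mul_of_nonneg_left (hK y hy) (by positivity)
    · filter_upwards [ae_restrict_of_ae (ae_ne_zero hm1)] with y hy0
      have : 0 < ‖y‖ ^ 2 := by positivity
      have hk0 := truncatedKernel_nonneg (B := (1 / 2) ^ 2) hβ this
      rw [← sq_norm_rpow_neg, ← mul_neg]
      exact (mul_le_mul_of_nonneg_left (le_max_left _ 0) hk0).trans
        (mul_le_mul_of_nonneg_right (truncatedKernel_le hβ this) (le_max_right _ _))
  have h2 : ∫ y in ball 0 (1 / 2), u (x + y) * (a * ((1 / 2) ^ 2 - ‖y‖ ^ 2)) ≤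
      a * ∫ y in ball 0 (5 / 2), u y := by
    calc _ ≤ ∫ y in ball 0 (1 / 2), a * u (x + y) := by
          have hic : Continuous fun y => u (x + y) * (a * ((1 / 2) ^ 2 - ‖y‖ ^ 2)) := by fun_prop
          refine setIntegral_mono_on (integrableOn_ball_of_continuous hic _ _)
            ((integrableOn_ball_of_continuous huc _ _).const_mul a) measurableSet_ball
            fun y hy => ?_
          have hau : 0 ≤ a * u (x + y) := mul_nonneg ha0.le (hball y hy)
          nlinarith [sq_nonneg ‖y‖, mul_nonneg hau (sq_nonneg ‖y‖)]
      _ = a * ∫ y in ball x (1 / 2), u y := by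
          rw [integral_const_mul, setIntegral_ball_comp_add u]
      _ ≤ _ := by
          refine mul_le_mul_of_nonneg_left ?_ ha0.le
          refine setIntegral_mono_set (integrableOn_ball_of_continuous hu.continuous _ _) ?_
            hsub.eventuallyLE
          filter_upwards [ae_restrict_mem measurableSet_ball] with y hy using hu0 y (hsub4 hy)
  rw [hid] at h1
  set J := ∫ y in ball 0 (1 / 2), u (x + y) * (a * ((1 / 2) ^ 2 - ‖y‖ ^ 2))
  set N := ∫ y in ball 0 (1 / 2), ‖y‖ ^ (-(2 * β)) * max (-euclideanLaplacian u (x + y)) 0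
  set I := ∫ y in ball 0 (5 / 2), u y
  have hN0 : 0 ≤ N := integral_nonneg fun y => mul_nonneg (by positivity) (le_max_right _ _)
  have hI0 : 0 ≤ I := setIntegral_nonneg measurableSet_ball fun y hy => hu0 y (hsub4 hy)
  rw [div_mul_eq_mul_div, le_div_iff₀ (by positivity)]
  have h3 := mul_le_mul_of_nonneg_left h2 hκ0.le
  have h4 : 0 ≤ κ * a * N := by positivity
  have h1' : -(κ * (J - S * u x)) ≤ N := h1
  linarith

/-- Young's convolution inequality for `L^p * L^1`. -/
theorem lintegral_rpow_lintegral_mul_comp_add_le {m : ℕ} {p : ℝ} (hp : 1 ≤ p)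
    {K H : EuclideanSpace ℝ (Fin m) → ENNReal} (hK : Measurable K) (hH : Measurable H) :
    ∫⁻ x, (∫⁻ y, K y * H (x + y)) ^ p ≤ (∫⁻ y, K y ^ p) * (∫⁻ y, H y) ^ p := by
  have hp0 : 0 < p := by linarith
  have hp' : 0 ≤ 1 - 1 / p := by
    rw [sub_nonneg, div_le_one hp0]
    exact hp
  have key : ∀ x, (∫⁻ y, K y * H (x + y)) ^ p ≤
      (∫⁻ y, K y ^ p * H (x + y)) * (∫⁻ y, H y) ^ (p - 1) := by
    intro x
    have h := ENNReal.lintegral_mul_norm_pow_le (μ := volume)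
      (f := fun y => K y ^ p * H (x + y)) (g := fun y => H (x + y))
      (by fun_prop) (by fun_prop) (p := 1 / p) (q := 1 - 1 / p) (by positivity) hp' (by ring)
    have e : ∀ y, (K y ^ p * H (x + y)) ^ (1 / p) * H (x + y) ^ (1 - 1 / p) = K y * H (x + y) := by
      intro y
      rw [ENNReal.mul_rpow_of_nonneg _ _ (by positivity), ← ENNReal.rpow_mul,
        mul_one_div_cancel hp0.ne', ENNReal.rpow_one, mul_assoc,
        ← ENNReal.rpow_add_of_nonneg _ _ (by positivity) hp']
      simp
    simp_rw [e] at h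
    rw [lintegral_add_left_eq_self H x] at h
    refine (ENNReal.rpow_le_rpow h hp0.le).trans_eq ?_
    rw [ENNReal.mul_rpow_of_nonneg _ _ hp0.le, ← ENNReal.rpow_mul, ← ENNReal.rpow_mul,
      one_div_mul_cancel hp0.ne', ENNReal.rpow_one]
    congr 2
    field_simp
  refine (lintegral_mono key).trans_eq ?_
  rw [lintegral_mul_const'' _ (by fun_prop), lintegral_lintegral_swap (by fun_prop)]
  have e : ∀ y, ∫⁻ x, K y ^ p * H (x + y) = K y ^ p * ∫⁻ x, H x := fun y => by
    rw [lintegral_const_mul _ (by fun_prop), lintegral_add_right_eq_self H y]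
  simp_rw [e]
  rw [lintegral_mul_const _ (by fun_prop), mul_assoc]
  congr 1
  nth_rw 1 [← ENNReal.rpow_one (∫⁻ y, H y)]
  rw [← ENNReal.rpow_add_of_nonneg _ _ zero_le_one (by linarith)]
  congr 1
  ring

/-- The weak Harnack inequality at unit scale. -/
theorem exists_rpow_setIntegral_rpow_le_apply_add {m : ℕ} {β s p : ℝ}
    (hm : (m : ℝ) = 2 * β + 2) (hβ : 0 < β) (hs : β + 1 < s) (hp1 : 1 ≤ p)
    (hp : 2 * β * p < m) :
    ∃ C, 0 < C ∧ ∀ u f : EuclideanSpace ℝ (Fin m) → ℝ, ContDiff ℝ 2 u → Continuous f →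
      (∀ x ∈ ball 0 4, 0 ≤ u x) → (∀ x ∈ ball 0 4, euclideanLaplacian u x ≤ f x) →
      ∀ x ∈ ball 0 1,
      (∫ y in ball 0 2, u y ^ p) ^ (1 / p) ≤
        C * (u x + (∫ y in ball (0 : EuclideanSpace ℝ (Fin m)) 4, |f y| ^ s) ^ (1 / s)) := by
  have hm1 : 1 ≤ m := by
    have : (0 : ℝ) < m := by linarith
    exact_mod_cast this
  have hp0 : 0 < p := by linarith
  obtain ⟨C₁, hC₁0, hC₁⟩ := exists_apply_le_newton_add hm hβ
  obtain ⟨C₂, hC₂0, hC₂⟩ := exists_setIntegral_ball_zero_le_apply_add hm hβ hs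
  set K : EuclideanSpace ℝ (Fin m) → ENNReal :=
    (ball 0 (1 / 2)).indicator fun y => ENNReal.ofReal (‖y‖ ^ (-(2 * β))) with hK
  have hKm : Measurable K := Measurable.indicator (by fun_prop) measurableSet_ball
  have hKp : ∫⁻ y, K y ^ p ≠ ⊤ := by
    have e : ∀ y, K y ^ p = (ball (0 : EuclideanSpace ℝ (Fin m)) (1 / 2)).indicator
        (fun y => ENNReal.ofReal (‖y‖ ^ (-(2 * β * p)))) y := fun y => by
      by_cases hy : y ∈ ball (0 : EuclideanSpace ℝ (Fin m)) (1 / 2)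
      · rw [hK, indicator_of_mem hy, indicator_of_mem hy,
          ENNReal.ofReal_rpow_of_nonneg (by positivity) hp0.le, ← Real.rpow_mul (norm_nonneg y),
          neg_mul]
      · rw [hK, indicator_of_notMem hy, indicator_of_notMem hy, ENNReal.zero_rpow_of_pos hp0]
    simp_rw [e]
    rw [lintegral_indicator measurableSet_ball]
    exact (integrableOn_norm_rpow_ball hm1 hp (1 / 2)).lintegral_lt_top.ne
  set M := (∫⁻ y, K y ^ p) ^ (1 / p) with hM
  have hMtop : M ≠ ⊤ := ENNReal.rpow_ne_top_of_nonneg (by positivity) hKp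
  set W := volume (ball (0 : EuclideanSpace ℝ (Fin m)) 2) ^ (1 / p) with hW
  have hWtop : W ≠ ⊤ := ENNReal.rpow_ne_top_of_nonneg (by positivity) measure_ball_lt_top.ne
  refine ⟨C₁ * (M.toReal + W.toReal) * C₂ + 1, by positivity, fun u f hu hf hu0 hle x hx => ?_⟩
  obtain ⟨hIle, hhle⟩ := hC₂ u f hu hf hu0 hle x hx
  set F := (∫ y in ball (0 : EuclideanSpace ℝ (Fin m)) 4, |f y| ^ s) ^ (1 / s) with hF
  have hF0 : 0 ≤ F := by positivity
  have hux : 0 ≤ u x := hu0 x (ball_subset_ball (by norm_num) hx)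
  have hh : Continuous fun y => max (-euclideanLaplacian u y) 0 := by
    have := continuous_euclideanLaplacian hu
    fun_prop
  set h := fun y => max (-euclideanLaplacian u y) 0 with hhdef
  have hh0 : ∀ y, 0 ≤ h y := fun y => le_max_right _ _
  set I := ∫ y in ball 0 (5 / 2), u y with hI
  have hI0 : 0 ≤ I := setIntegral_nonneg measurableSet_ball fun y hy =>
    hu0 y (ball_subset_ball (by norm_num) hy)
  set H : EuclideanSpace ℝ (Fin m) → ENNReal :=
    (ball 0 (5 / 2)).indicator fun y => ENNReal.ofReal (h y) with hH
  have hHm : Measurable H :=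
    Measurable.indicator hh.measurable.ennreal_ofReal measurableSet_ball
  have hHint : ∫⁻ y, H y = ENNReal.ofReal (∫ y in ball 0 (5 / 2), h y) := by
    rw [lintegral_indicator measurableSet_ball, ofReal_integral_eq_lintegral_ofReal
      (integrableOn_ball_of_continuous hh _ _) (Eventually.of_forall hh0)]
  set A : EuclideanSpace ℝ (Fin m) → ENNReal := fun z => ∫⁻ y, K y * H (z + y) with hA
  have hAm : Measurable A := Measurable.lintegral_prod_right'
    (f := fun z : EuclideanSpace ℝ (Fin m) × EuclideanSpace ℝ (Fin m) => K z.2 * H (z.1 + z.2))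
    (by fun_prop)
  have hpt : ∀ z ∈ ball (0 : EuclideanSpace ℝ (Fin m)) 2,
      ENNReal.ofReal (u z) ≤ ENNReal.ofReal C₁ * (A z + ENNReal.ofReal I) := by
    intro z hz
    have hnewton : ENNReal.ofReal (∫ y in ball 0 (1 / 2), ‖y‖ ^ (-(2 * β)) * h (z + y)) ≤ A z := by
      refine (Real.ofReal_le_enorm _).trans ((enorm_integral_le_lintegral_enorm _).trans ?_)
      rw [← lintegral_indicator measurableSet_ball]
      refine lintegral_mono fun y => ?_
      by_cases hy : y ∈ ball (0 : EuclideanSpace ℝ (Fin m)) (1 / 2)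
      · have hzy : z + y ∈ ball (0 : EuclideanSpace ℝ (Fin m)) (5 / 2) := by
          rw [mem_ball_zero_iff] at *
          linarith [norm_add_le z y]
        rw [hK, hH, indicator_of_mem hy, indicator_of_mem hy, indicator_of_mem hzy,
          Real.enorm_of_nonneg (mul_nonneg (by positivity) (hh0 _)),
          ENNReal.ofReal_mul (by positivity)]
      · rw [indicator_of_notMem hy]
        exact zero_le
    refine (ENNReal.ofReal_le_ofReal (hC₁ u hu hu0 z hz)).trans ?_
    rw [ENNReal.ofReal_mul hC₁0.le, ENNReal.ofReal_add
      (integral_nonneg fun y => mul_nonneg (by positivity) (hh0 _)) hI0]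
    gcongr
  have hmink : (∫⁻ z in ball 0 2, ENNReal.ofReal (u z) ^ p) ^ (1 / p) ≤
      ENNReal.ofReal C₁ * (M * ENNReal.ofReal (∫ y in ball 0 (5 / 2), h y) +
        ENNReal.ofReal I * W) := by
    calc (∫⁻ z in ball 0 2, ENNReal.ofReal (u z) ^ p) ^ (1 / p)
        ≤ (∫⁻ z in ball 0 2, ENNReal.ofReal C₁ ^ p * (A z + ENNReal.ofReal I) ^ p) ^ (1 / p) := by
          refine ENNReal.rpow_le_rpow (setLIntegral_mono' measurableSet_ball fun z hz => ?_)
            (by positivity)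
          rw [← ENNReal.mul_rpow_of_nonneg _ _ hp0.le]
          exact ENNReal.rpow_le_rpow (hpt z hz) hp0.le
      _ = ENNReal.ofReal C₁ * (∫⁻ z in ball 0 2, (A z + ENNReal.ofReal I) ^ p) ^ (1 / p) := by
          rw [lintegral_const_mul _ (by fun_prop), ENNReal.mul_rpow_of_nonneg _ _ (by positivity),
            ← ENNReal.rpow_mul, mul_one_div_cancel hp0.ne', ENNReal.rpow_one]
      _ ≤ ENNReal.ofReal C₁ * ((∫⁻ z in ball 0 2, A z ^ p) ^ (1 / p) +
            (∫⁻ z in ball (0 : EuclideanSpace ℝ (Fin m)) 2, ENNReal.ofReal I ^ p) ^ (1 / p)) := by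
          gcongr
          exact ENNReal.lintegral_Lp_add_le (g := fun _ => ENNReal.ofReal I)
            hAm.aemeasurable aemeasurable_const hp1
      _ ≤ _ := by
          gcongr
          · refine (ENNReal.rpow_le_rpow ((setLIntegral_le_lintegral _ _).trans
              (lintegral_rpow_lintegral_mul_comp_add_le hp1 hKm hHm)) (by positivity)).trans_eq ?_
            rw [hHint, ENNReal.mul_rpow_of_nonneg _ _ (by positivity), ← ENNReal.rpow_mul _ p,
              mul_one_div_cancel hp0.ne', ENNReal.rpow_one]
          · rw [lintegral_const, Measure.restrict_apply_univ,
              ENNReal.mul_rpow_of_nonneg _ _ (by positivity), ← ENNReal.rpow_mul,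
              mul_one_div_cancel hp0.ne', ENNReal.rpow_one]
  have hlhs : (∫ y in ball 0 2, u y ^ p) ^ (1 / p) =
      ((∫⁻ z in ball 0 2, ENNReal.ofReal (u z) ^ p) ^ (1 / p)).toReal := by
    rw [← ENNReal.toReal_rpow, integral_eq_lintegral_of_nonneg_ae]
    · congr 2
      refine setLIntegral_congr_fun measurableSet_ball fun z hz => ?_
      exact (ENNReal.ofReal_rpow_of_nonneg (hu0 z (ball_subset_ball (by norm_num) hz)) hp0.le).symm
    · filter_upwards [ae_restrict_mem measurableSet_ball] with z hz
      exact Real.rpow_nonneg (hu0 z (ball_subset_ball (by norm_num) hz)) _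
    · exact (hu.continuous.rpow_const fun _ => Or.inr hp0.le).aestronglyMeasurable
  have hhI0 : 0 ≤ ∫ y in ball 0 (5 / 2), h y := integral_nonneg hh0
  rw [hlhs]
  refine (ENNReal.toReal_mono (by finiteness) hmink).trans ?_
  rw [ENNReal.toReal_mul, ENNReal.toReal_add (by finiteness) (by finiteness), ENNReal.toReal_mul,
    ENNReal.toReal_mul, ENNReal.toReal_ofReal hC₁0.le, ENNReal.toReal_ofReal hhI0,
    ENNReal.toReal_ofReal hI0]
  calc _ ≤ C₁ * (M.toReal * (C₂ * (u x + F)) + (C₂ * (u x + F)) * W.toReal) := by gcongr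
    _ = C₁ * (M.toReal + W.toReal) * C₂ * (u x + F) := by ring
    _ ≤ _ := by
        gcongr
        linarith

theorem setIntegral_ball_comp_smul {m : ℕ} (w : EuclideanSpace ℝ (Fin m) → ℝ) {r : ℝ}
    (hr : 0 < r) (ρ : ℝ) :
    ∫ y in ball 0 ρ, w (r • y) = r ^ (-(m : ℝ)) * ∫ y in ball 0 (ρ * r), w y := by
  rw [Measure.setIntegral_comp_smul_of_pos volume w (ball 0 ρ) hr, finrank_euclideanSpace_fin,
    _root_.smul_ball hr.ne', smul_zero, Real.norm_of_nonneg hr.le, smul_eq_mul, Real.rpow_neg hr.le,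
    Real.rpow_natCast, mul_comm r]

/-- weak Harnack inequality, Gilbarg–Trudinger Thm 8.18:
for `m ≥ 3`, `R > 0`, `1 ≤ p < m/(m-2)`, `q > m`, there is `C = C(m,R,p,q) > 0`
such that any `u ∈ C²(ℝᵐ)` non-negative on `B_R(0)` with `Δu ≤ f` on `B_R(0)`
satisfies
`r^{-m/p} ‖u‖_{L^p(B_{2r})} ≤ C (inf_{B_r} u + r^{2-2m/q} ‖f‖_{L^{q/2}(B_R)})`
for all `0 < r < R/4`. -/
theorem weak_harnack_inequality
    (m : ℕ) (hm : 3 ≤ m) (R : ℝ) (hR : 0 < R) (p q : ℝ)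
    (hp1 : 1 ≤ p) (hp2 : p < (m : ℝ) / ((m : ℝ) - 2)) (hq : (m : ℝ) < q) :
    ∃ C : ℝ, 0 < C ∧
      ∀ (u f : EuclideanSpace ℝ (Fin m) → ℝ), ContDiff ℝ 2 u → Continuous f →
        (∀ x ∈ ball (0 : EuclideanSpace ℝ (Fin m)) R, 0 ≤ u x) →
        (∀ x ∈ ball (0 : EuclideanSpace ℝ (Fin m)) R, euclideanLaplacian u x ≤ f x) →
        ∀ r : ℝ, 0 < r → r < R / 4 →
          r ^ (-(m : ℝ) / p) *
              (∫ x in ball (0 : EuclideanSpace ℝ (Fin m)) (2 * r), u x ^ p) ^ (1 / p) ≤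
            C * (sInf (u '' ball (0 : EuclideanSpace ℝ (Fin m)) r) +
              r ^ (2 - 2 * (m : ℝ) / q) *
                (∫ x in ball (0 : EuclideanSpace ℝ (Fin m)) R, |f x| ^ (q / 2)) ^ (2 / q)) := by
  have hm3 : (3 : ℝ) ≤ m := by exact_mod_cast hm
  have hp0 : 0 < p := by linarith
  have hq0 : 0 < q := by linarith
  obtain ⟨C, hC0, hC⟩ := exists_rpow_setIntegral_rpow_le_apply_add (m := m)
    (β := ((m : ℝ) - 2) / 2) (s := q / 2) (p := p) (by ring) (by linarith) (by linarith) hp1 (by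
      rw [lt_div_iff₀ (by linarith)] at hp2
      linarith)
  refine ⟨C, hC0, fun u f hu hf hu0 hle r hr hrR => ?_⟩
  have hmem : ∀ y ∈ ball (0 : EuclideanSpace ℝ (Fin m)) 4,
      r • y ∈ ball (0 : EuclideanSpace ℝ (Fin m)) R := by
    intro y hy
    rw [mem_ball_zero_iff] at *
    rw [norm_smul, Real.norm_of_nonneg hr.le]
    nlinarith
  have hlhs : (∫ y in ball (0 : EuclideanSpace ℝ (Fin m)) 2, u (r • y) ^ p) ^ (1 / p) =
      r ^ (-(m : ℝ) / p) *
        (∫ x in ball (0 : EuclideanSpace ℝ (Fin m)) (2 * r), u x ^ p) ^ (1 / p) := by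
    rw [setIntegral_ball_comp_smul (fun y => u y ^ p) hr, Real.mul_rpow (by positivity)
      (setIntegral_nonneg measurableSet_ball fun y hy => Real.rpow_nonneg
        (hu0 y (ball_subset_ball (by linarith) hy)) _), ← Real.rpow_mul hr.le, mul_one_div]
  have hrhs : (∫ y in ball (0 : EuclideanSpace ℝ (Fin m)) 4, |r ^ 2 * f (r • y)| ^ (q / 2)) ^
      (1 / (q / 2)) ≤ r ^ (2 - 2 * (m : ℝ) / q) *
        (∫ x in ball (0 : EuclideanSpace ℝ (Fin m)) R, |f x| ^ (q / 2)) ^ (2 / q) := by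
    have e : ∀ y, |r ^ 2 * f (r • y)| ^ (q / 2) = r ^ q * |f (r • y)| ^ (q / 2) := fun y => by
      rw [abs_mul, Real.mul_rpow (abs_nonneg _) (abs_nonneg _), abs_of_pos (by positivity),
        ← Real.rpow_natCast, ← Real.rpow_mul hr.le]
      congr 2
      push_cast
      ring
    simp_rw [e]
    rw [integral_const_mul, setIntegral_ball_comp_smul (fun y => |f y| ^ (q / 2)) hr, ← mul_assoc,
      ← Real.rpow_add hr, Real.mul_rpow (by positivity) (integral_nonneg fun y => by positivity),
      ← Real.rpow_mul hr.le, one_div_div, show (q + -(m : ℝ)) * (2 / q) = 2 - 2 * m / q by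
        field_simp
        ring]
    refine mul_le_mul_of_nonneg_left (Real.rpow_le_rpow (integral_nonneg fun y => by positivity)
      ?_ (by positivity)) (by positivity)
    exact setIntegral_mono_set (integrableOn_ball_of_continuous
      (hf.abs.rpow_const fun _ => Or.inr (by positivity)) _ _)
      (Eventually.of_forall fun y => by positivity)
      (ball_subset_ball (by linarith)).eventuallyLE
  have hΔ : ∀ y, euclideanLaplacian (fun y => u (r • y)) y = r ^ 2 * euclideanLaplacian u (r • y) :=
    fun y => by simpa using euclideanLaplacian_comp_add_smul hu 0 r y
  rw [← hlhs, ← div_le_iff₀' hC0, ← sub_le_iff_le_add]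
  refine le_csInf ((nonempty_ball.2 hr).image u) ?_
  rintro _ ⟨x, hx, rfl⟩
  have h := hC (fun y => u (r • y)) (fun y => r ^ 2 * f (r • y)) (hu.comp (by fun_prop))
    (by fun_prop) (fun y hy => hu0 _ (hmem y hy))
    (fun y hy => by
      rw [hΔ]
      exact mul_le_mul_of_nonneg_left (hle _ (hmem y hy)) (by positivity))
    (r⁻¹ • x) (by
      rw [mem_ball_zero_iff] at *
      rwa [norm_smul, norm_inv, Real.norm_of_nonneg hr.le, inv_mul_lt_iff₀ hr, mul_one])
  rw [smul_inv_smul₀ hr.ne'] at h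
  rw [sub_le_iff_le_add, div_le_iff₀' hC0]
  exact h.trans (mul_le_mul_of_nonneg_left (add_le_add_right hrhs _) hC0.le)
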